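/- Let α > 0 be real and let k be a positive integer. Then Re(log(w(α/(2πk))) − 1/w(α/(2πk))) ≤ Re(log(w(α/(2π))) − 1/w(α/(2π))), where log denotes the principal complex logarithm. -/

import Mathlib

open Real

/-- A point `z` of the strip `0 < Im z < π / 2` with `z * exp z` on the imaginary axis satisfies
`Re z = y * tan y`, where `y = Im z`. -/
theorem re_eq_im_mul_tan {z : ℂ} {t : ℝ} (h0 : 0 < z.im) (h1 : z.im < π / 2)
    (h : z * Complex.exp z = Complex.I * t) : z.re = z.im * tan z.im := by
  have hc : 0 < cos z.im := cos_pos_of_mem_Ioo ⟨by linarith [pi_pos], h1⟩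
  have hre := congrArg Complex.re h
  simp only [Complex.mul_re, Complex.exp_re, Complex.exp_im, Complex.I_re, Complex.I_im,
    Complex.ofReal_re, Complex.ofReal_im] at hre
  have hx : z.re * cos z.im = z.im * sin z.im := by
    apply mul_left_cancel₀ (exp_pos z.re).ne'
    linarith
  rw [tan_eq_sin_div_cos]
  field_simp
  exact hx

theorem eq_exp_mul_im_div_cos {z : ℂ} {t : ℝ} (h0 : 0 < z.im) (h1 : z.im < π / 2)
    (h : z * Complex.exp z = Complex.I * t) :
    t = exp (z.im * tan z.im) * (z.im / cos z.im) := by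
  have hc : 0 < cos z.im := cos_pos_of_mem_Ioo ⟨by linarith [pi_pos], h1⟩
  have him := congrArg Complex.im h
  simp only [Complex.mul_im, Complex.exp_re, Complex.exp_im, Complex.I_re, Complex.I_im,
    Complex.ofReal_re, Complex.ofReal_im] at him
  rw [re_eq_im_mul_tan h0 h1 h] at him
  have ht : t = exp (z.im * tan z.im) * (z.im * (tan z.im * sin z.im + cos z.im)) := by
    linarith
  have hsec : tan z.im * sin z.im + cos z.im = 1 / cos z.im := by
    rw [tan_eq_sin_div_cos]
    field_simp
    exact sin_sq_add_cos_sq _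
  rw [ht, hsec, mul_one_div]

theorem log_sub_inv_re_eq {z : ℂ} {t : ℝ} (h0 : 0 < z.im) (h1 : z.im < π / 2)
    (h : z * Complex.exp z = Complex.I * t) :
    (Complex.log z - 1 / z).re = log (z.im / cos z.im) - sin z.im / z.im * cos z.im := by
  have hc : 0 < cos z.im := cos_pos_of_mem_Ioo ⟨by linarith [pi_pos], h1⟩
  have hsq : Complex.normSq z = (z.im / cos z.im) ^ 2 := by
    rw [Complex.normSq_apply, re_eq_im_mul_tan h0 h1 h, tan_eq_sin_div_cos]
    field_simp
    exact sin_sq_add_cos_sq _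
  have hnorm : ‖z‖ = z.im / cos z.im := by
    rw [Complex.normSq_eq_norm_sq] at hsq
    exact (sq_eq_sq₀ (norm_nonneg z) (by positivity)).1 hsq
  rw [Complex.sub_re, Complex.log_re, one_div, Complex.inv_re, hsq, hnorm,
    re_eq_im_mul_tan h0 h1 h, tan_eq_sin_div_cos]
  field_simp

theorem sin_div_self_le_of_le {a b : ℝ} (ha : 0 < a) (hab : a ≤ b) (hb : b ≤ π) :
    sin b / b ≤ sin a / a := by
  have hb0 : 0 < b := ha.trans_le hab
  have h := strictConcaveOn_sin_Icc.concaveOn.2 (Set.left_mem_Icc.2 pi_pos.le)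
    (Set.mem_Icc.2 ⟨hb0.le, hb⟩) (sub_nonneg.2 ((div_le_one hb0).2 hab))
    (div_nonneg ha.le hb0.le) (sub_add_cancel 1 (a / b))
  simp only [smul_eq_mul, sin_zero, mul_zero, zero_add, div_mul_cancel₀ _ hb0.ne'] at h
  rw [le_div_iff₀ ha]
  calc sin b / b * a = a / b * sin b := by ring
    _ ≤ sin a := h

theorem div_cos_lt_div_cos {a b : ℝ} (ha : 0 < a) (hab : a < b) (hb : b < π / 2) :
    a / cos a < b / cos b := by
  have hcb : 0 < cos b := cos_pos_of_mem_Ioo ⟨by linarith, hb⟩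
  exact div_lt_div₀ hab (cos_le_cos_of_nonneg_of_le_pi ha.le (by linarith) hab.le)
    (ha.trans hab).le hcb

/-- The imaginary part of a solution of `z * exp z = I * t` in the strip `0 < Im z < π / 2` is
monotone in `t`. -/
theorem im_le_im_of_mul_exp_eq {z₁ z₂ : ℂ} {t₁ t₂ : ℝ} (h₁ : 0 < z₁.im) (h₁' : z₁.im < π / 2)
    (e₁ : z₁ * Complex.exp z₁ = Complex.I * t₁) (h₂ : 0 < z₂.im) (h₂' : z₂.im < π / 2)
    (e₂ : z₂ * Complex.exp z₂ = Complex.I * t₂) (ht : t₁ ≤ t₂) : z₁.im ≤ z₂.im := by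
  by_contra! hlt
  refine ht.not_gt ?_
  rw [eq_exp_mul_im_div_cos h₁ h₁' e₁, eq_exp_mul_im_div_cos h₂ h₂' e₂]
  have htan : tan z₂.im ≤ tan z₁.im :=
    (tan_lt_tan_of_nonneg_of_lt_pi_div_two h₂.le h₁' hlt).le
  have htan0 : 0 < tan z₂.im := tan_pos_of_pos_of_lt_pi_div_two h₂ h₂'
  have hc : 0 < cos z₂.im := cos_pos_of_mem_Ioo ⟨by linarith [pi_pos], h₂'⟩
  exact mul_lt_mul' (exp_le_exp.2 (mul_le_mul hlt.le htan htan0.le h₁.le))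
    (div_cos_lt_div_cos h₂ hlt h₁') (by positivity) (exp_pos _)

/-- `Re (log z - 1 / z)` is monotone in `t` along the solutions of `z * exp z = I * t` in the strip
`0 < Im z < π / 2`. -/
theorem log_sub_inv_re_le {z₁ z₂ : ℂ} {t₁ t₂ : ℝ} (h₁ : 0 < z₁.im) (h₁' : z₁.im < π / 2)
    (e₁ : z₁ * Complex.exp z₁ = Complex.I * t₁) (h₂ : 0 < z₂.im) (h₂' : z₂.im < π / 2)
    (e₂ : z₂ * Complex.exp z₂ = Complex.I * t₂) (ht : t₁ ≤ t₂) :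
    (Complex.log z₁ - 1 / z₁).re ≤ (Complex.log z₂ - 1 / z₂).re := by
  have hy := im_le_im_of_mul_exp_eq h₁ h₁' e₁ h₂ h₂' e₂ ht
  have hc₁ : 0 < cos z₁.im := cos_pos_of_mem_Ioo ⟨by linarith, h₁'⟩
  have hc₂ : 0 < cos z₂.im := cos_pos_of_mem_Ioo ⟨by linarith, h₂'⟩
  have hcos : cos z₂.im ≤ cos z₁.im := cos_le_cos_of_nonneg_of_le_pi h₁.le (by linarith) hy
  have hsin : 0 < sin z₁.im := sin_pos_of_pos_of_lt_pi h₁ (by linarith)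
  rw [log_sub_inv_re_eq h₁ h₁' e₁, log_sub_inv_re_eq h₂ h₂' e₂]
  exact sub_le_sub (log_le_log (by positivity) (div_le_div₀ h₂.le hy hc₂ hcos))
    (mul_le_mul (sin_div_self_le_of_le h₁ hy (by linarith)) hcos hc₂.le (by positivity))

/-- **Monotonicity in `k`.** For real `α > 0` and a positive integer `k`,
`Re(log(w(α/(2πk))) − 1/w(α/(2πk))) ≤ Re(log(w(α/(2π))) − 1/w(α/(2π)))`,
where `w t = W₀(it)` and `log` is the principal complex logarithm. -/
theorem saddle_value_k_le_one (α : ℝ) (hα : 0 < α) (k : ℕ) (hk : 0 < k)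
    (w : ℝ → ℂ)
    (hw : ∀ t : ℝ, 0 < t → 0 < (w t).im ∧ (w t).im < π / 2 ∧
      w t * Complex.exp (w t) = Complex.I * t) :
    (Complex.log (w (α / (2 * π * k))) - 1 / w (α / (2 * π * k))).re
      ≤ (Complex.log (w (α / (2 * π))) - 1 / w (α / (2 * π))).re := by
  have hk1 : (1 : ℝ) ≤ k := by exact_mod_cast hk
  have hπ : 0 < 2 * π := by positivity
  obtain ⟨h₁, h₁', e₁⟩ := hw (α / (2 * π * k)) (by positivity)
  obtain ⟨h₂, h₂', e₂⟩ := hw (α / (2 * π)) (by positivity)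
  exact log_sub_inv_re_le h₁ h₁' e₁ h₂ h₂' e₂
    (div_le_div_of_nonneg_left hα.le hπ (le_mul_of_one_le_right hπ.le hk1))
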